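/- arXiv:2503.21452 — 2 statements merged into one kernel-verified Lean document; each statement's English description precedes it below -/
import Mathlib

section
/- A continuous function x : [t₀,T] → ℝ solves the loaded Volterra integral equation if and only if it satisfies the reduced (load-only) equation x(t) + Σ_{j=1}^{m−1} b_j(t,λ) x(t_j) = F(t,λ) for all t ∈ [t₀,T]. -/
open MeasureTheory

/-- The iterated kernels of a Volterra kernel, indexed so that `K` itself has index `0`. -/
noncomputable def iteratedKernel (K : ℝ → ℝ → ℝ) : ℕ → ℝ → ℝ → ℝ
  | 0 => K
  | n + 1 => fun t s => ∫ z in s..t, K t z * iteratedKernel K n z s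

/-- The resolvent (Neumann series) of the Volterra kernel `K` at the parameter `lam`. -/
noncomputable def resolventKernel (K : ℝ → ℝ → ℝ) (lam t s : ℝ) : ℝ :=
  ∑' n : ℕ, lam ^ (n + 1) * iteratedKernel K n t s

/-- Fubini's theorem on the triangle `a ≤ s ≤ z ≤ t`. -/
theorem integral_integral_swap_triangle {h : ℝ → ℝ → ℝ} (hc : Continuous (Function.uncurry h))
    {a t : ℝ} (hat : a ≤ t) :
    ∫ z in a..t, ∫ s in a..z, h z s = ∫ s in a..t, ∫ z in s..t, h z s := by
  have hmeas : MeasurableSet {q : ℝ × ℝ | q.2 ≤ q.1} :=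
    measurableSet_le measurable_snd measurable_fst
  have hint : IntegrableOn
      (Function.uncurry fun z s => {q : ℝ × ℝ | q.2 ≤ q.1}.indicator (Function.uncurry h) (z, s))
      (Set.uIoc a t ×ˢ Set.uIoc a t) := by
    have hK : IntegrableOn (Function.uncurry h) (Set.uIcc a t ×ˢ Set.uIcc a t)
        volume :=
      hc.continuousOn.integrableOn_compact (isCompact_uIcc.prod isCompact_uIcc)
    exact (hK.mono_set (Set.prod_mono Set.uIoc_subset_uIcc Set.uIoc_subset_uIcc)).indicator hmeas
  have hswap := intervalIntegral_intervalIntegral_swap hint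
  have hleft : ∫ z in a..t, ∫ s in a..z, h z s = ∫ z in a..t, ∫ s in a..t,
      {q : ℝ × ℝ | q.2 ≤ q.1}.indicator (Function.uncurry h) (z, s) := by
    refine intervalIntegral.integral_congr fun z hz => ?_
    rw [Set.uIcc_of_le hat] at hz
    exact (intervalIntegral.integral_indicator (f := h z) hz).symm
  have hright : ∫ s in a..t, ∫ z in s..t, h z s = ∫ s in a..t, ∫ z in a..t,
      {q : ℝ × ℝ | q.2 ≤ q.1}.indicator (Function.uncurry h) (z, s) := by
    rw [intervalIntegral.integral_of_le hat, intervalIntegral.integral_of_le hat]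
    refine setIntegral_congr_fun measurableSet_Ioc fun s hs => ?_
    have hinter : Set.Ioc a t ∩ Set.Ici s = Set.Icc s t := by
      ext z
      simp only [Set.mem_inter_iff, Set.mem_Ioc, Set.mem_Ici, Set.mem_Icc]
      constructor
      · rintro ⟨⟨_, h2⟩, h3⟩
        exact ⟨h3, h2⟩
      · rintro ⟨h1, h2⟩
        exact ⟨⟨hs.1.trans_le h1, h2⟩, h1⟩
    have hind : ∀ z, {q : ℝ × ℝ | q.2 ≤ q.1}.indicator (Function.uncurry h) (z, s) =
        (Set.Ici s).indicator (fun z => h z s) z := fun z => rfl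
    simp only [hind]
    rw [intervalIntegral.integral_of_le hs.2, intervalIntegral.integral_of_le hat,
      setIntegral_indicator measurableSet_Ici, hinter, integral_Icc_eq_integral_Ioc]
  rw [hleft, hright, hswap]

/-- Integrating a function bounded by `C |z - s| ^ n / n!` gains one power of `|t - s|`. -/
theorem abs_integral_le_of_abs_le_pow {φ : ℝ → ℝ} {s t C : ℝ} (n : ℕ)
    (hφ : ∀ z ∈ Set.uIoc s t, |φ z| ≤ C * (|z - s| ^ n / n.factorial)) :
    |∫ z in s..t, φ z| ≤ C * (|t - s| ^ (n + 1) / (n + 1).factorial) := by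
  have hcont : Continuous fun z : ℝ => C * (|z - s| ^ n / n.factorial) := by fun_prop
  have hint : IntegrableOn (fun z : ℝ => C * (|z - s| ^ n / n.factorial)) (Set.uIoc s t) :=
    (hcont.intervalIntegrable s t).def'
  calc |∫ z in s..t, φ z| = ‖∫ z in Set.uIoc s t, φ z‖ :=
        intervalIntegral.norm_integral_eq_norm_integral_uIoc φ
    _ ≤ ∫ z in Set.uIoc s t, C * (|z - s| ^ n / n.factorial) :=
        norm_integral_le_of_norm_le hint
          ((ae_restrict_iff' measurableSet_uIoc).2 (Filter.Eventually.of_forall hφ))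
    _ = C * (|t - s| ^ (n + 1) / (n + 1).factorial) := by
        rw [integral_const_mul, integral_div, integral_pow_abs_sub_uIoc, Nat.factorial_succ]
        push_cast
        rw [div_div]

theorem continuous_iteratedKernel {K : ℝ → ℝ → ℝ} (hK : Continuous (Function.uncurry K)) (n : ℕ) :
    Continuous (Function.uncurry (iteratedKernel K n)) := by
  induction n with
  | zero => exact hK
  | succ n ih =>
    have hintegrand : Continuous
        (Function.uncurry fun (q : ℝ × ℝ) z => K q.1 z * iteratedKernel K n z q.2) :=
      (hK.comp (by fun_prop : Continuous fun r : (ℝ × ℝ) × ℝ => (r.1.1, r.2))).mul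
        (ih.comp (by fun_prop : Continuous fun r : (ℝ × ℝ) × ℝ => (r.2, r.1.2)))
    have hsub := (intervalIntegral.continuous_parametric_intervalIntegral_of_continuous
      (μ := volume) (a₀ := 0) hintegrand continuous_fst).sub
      (intervalIntegral.continuous_parametric_intervalIntegral_of_continuous
      (μ := volume) (a₀ := 0) hintegrand continuous_snd)
    refine hsub.congr fun q => ?_
    have hq : Continuous fun z => K q.1 z * iteratedKernel K n z q.2 :=
      hintegrand.comp (Continuous.prodMk_right q)
    exact intervalIntegral.integral_interval_sub_left (hq.intervalIntegrable _ _)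
      (hq.intervalIntegrable _ _)

theorem abs_iteratedKernel_le {K : ℝ → ℝ → ℝ} {M : ℝ} (hM : ∀ t s, |K t s| ≤ M) (n : ℕ) (t s : ℝ) :
    |iteratedKernel K n t s| ≤ M ^ (n + 1) * (|t - s| ^ n / n.factorial) := by
  have hM0 : 0 ≤ M := (abs_nonneg _).trans (hM 0 0)
  induction n generalizing t with
  | zero => simpa [iteratedKernel] using hM t s
  | succ n ih =>
    refine abs_integral_le_of_abs_le_pow n fun z _ => ?_
    rw [abs_mul, pow_succ' M (n + 1), mul_assoc]
    exact mul_le_mul (hM t z) (ih z) (abs_nonneg _) hM0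

theorem summable_resolventBound (c L : ℝ) :
    Summable fun n : ℕ => c ^ (n + 1) * (L ^ n / n.factorial) := by
  refine ((Real.summable_pow_div_factorial (c * L)).mul_left c).congr fun n => ?_
  rw [mul_pow]
  ring

theorem abs_resolventTerm_le {K : ℝ → ℝ → ℝ} {M : ℝ} (hM : ∀ t s, |K t s| ≤ M) (lam : ℝ) (n : ℕ)
    {t s L : ℝ} (hL : |t - s| ≤ L) :
    |lam ^ (n + 1) * iteratedKernel K n t s| ≤ (|lam| * M) ^ (n + 1) * (L ^ n / n.factorial) := by
  have hM0 : 0 ≤ M := (abs_nonneg _).trans (hM 0 0)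
  rw [abs_mul, abs_pow, mul_pow, mul_assoc]
  refine mul_le_mul_of_nonneg_left ((abs_iteratedKernel_le hM n t s).trans ?_) (by positivity)
  gcongr

theorem summable_resolventTerm {K : ℝ → ℝ → ℝ} {M : ℝ} (hM : ∀ t s, |K t s| ≤ M) (lam t s : ℝ) :
    Summable fun n : ℕ => lam ^ (n + 1) * iteratedKernel K n t s :=
  (summable_resolventBound (|lam| * M) |t - s|).of_norm_bounded
    fun n => abs_resolventTerm_le hM lam n le_rfl

theorem continuous_resolventKernel {K : ℝ → ℝ → ℝ} (hK : Continuous (Function.uncurry K)) {M : ℝ}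
    (hM : ∀ t s, |K t s| ≤ M) (lam : ℝ) :
    Continuous (Function.uncurry (resolventKernel K lam)) := by
  rw [continuous_iff_continuousAt]
  intro q
  have hopen : IsOpen {r : ℝ × ℝ | |r.1 - r.2| < |q.1 - q.2| + 1} :=
    isOpen_lt (by fun_prop) continuous_const
  have hmem : q ∈ {r : ℝ × ℝ | |r.1 - r.2| < |q.1 - q.2| + 1} :=
    lt_add_one |q.1 - q.2|
  have hon : ContinuousOn (Function.uncurry (resolventKernel K lam))
      {r : ℝ × ℝ | |r.1 - r.2| < |q.1 - q.2| + 1} :=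
    continuousOn_tsum (fun n => ((continuous_iteratedKernel hK n).const_mul _).continuousOn)
      (summable_resolventBound (|lam| * M) (|q.1 - q.2| + 1))
      fun n r hr => abs_resolventTerm_le hM lam n (le_of_lt hr)
  exact hon.continuousAt (hopen.mem_nhds hmem)

/-- The resolvent equation `R = λ K + λ K ∗ R`. -/
theorem resolventKernel_eq {K : ℝ → ℝ → ℝ} (hK : Continuous (Function.uncurry K)) {M : ℝ}
    (hM : ∀ t s, |K t s| ≤ M) (lam t s : ℝ) :
    resolventKernel K lam t s =
      lam * K t s + lam * ∫ z in s..t, K t z * resolventKernel K lam z s := by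
  have hM0 : 0 ≤ M := (abs_nonneg _).trans (hM 0 0)
  have hterm : ∀ n, Continuous fun z => K t z * (lam ^ (n + 1) * iteratedKernel K n z s) :=
    fun n => (hK.comp (Continuous.prodMk_right t)).mul
      (((continuous_iteratedKernel hK n).comp (Continuous.prodMk_left s)).const_mul _)
  have hsum : HasSum (fun n : ℕ => ∫ z in s..t, K t z * (lam ^ (n + 1) * iteratedKernel K n z s))
      (∫ z in s..t, K t z * resolventKernel K lam z s) := by
    refine intervalIntegral.hasSum_integral_of_dominated_convergence
      (fun n _ => M * ((|lam| * M) ^ (n + 1) * (|t - s| ^ n / n.factorial)))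
      (fun n => (hterm n).aestronglyMeasurable) (fun n => ?_) ?_ ?_ ?_
    · refine Filter.Eventually.of_forall fun z hz => ?_
      rw [Real.norm_eq_abs, abs_mul]
      refine mul_le_mul (hM t z) (abs_resolventTerm_le hM lam n ?_) (abs_nonneg _) hM0
      exact Set.abs_sub_left_of_mem_uIcc (Set.uIoc_subset_uIcc hz)
    · exact Filter.Eventually.of_forall fun z _ => (summable_resolventBound _ _).mul_left M
    · exact intervalIntegrable_const
    · exact Filter.Eventually.of_forall fun z _ =>
        (summable_resolventTerm hM lam z s).hasSum.mul_left (K t z)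
  rw [← hsum.tsum_eq, ← tsum_mul_left, resolventKernel,
    (summable_resolventTerm hM lam t s).tsum_eq_zero_add]
  congr 1
  · simp [iteratedKernel]
  · refine tsum_congr fun n => ?_
    rw [← intervalIntegral.integral_const_mul, iteratedKernel,
      ← intervalIntegral.integral_const_mul]
    congr 1 with z
    ring

/-- A homogeneous Volterra equation has only the trivial continuous solution. -/
theorem eq_zero_of_volterra {K : ℝ → ℝ → ℝ} {M : ℝ} (hM : ∀ t s, |K t s| ≤ M) {lam a T : ℝ}
    {d : ℝ → ℝ} (hd : Continuous d)
    (h : ∀ t ∈ Set.Icc a T, d t = lam * ∫ s in a..t, K t s * d s) :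
    ∀ t ∈ Set.Icc a T, d t = 0 := by
  have hM0 : 0 ≤ M := (abs_nonneg _).trans (hM 0 0)
  obtain ⟨D, hD⟩ := (isCompact_Icc (a := a) (b := T)).exists_bound_of_continuousOn hd.continuousOn
  have hbound : ∀ n : ℕ, ∀ t ∈ Set.Icc a T,
      |d t| ≤ D * (|lam| * M) ^ n * (|t - a| ^ n / n.factorial) := by
    intro n
    induction n with
    | zero => simpa using hD
    | succ n ih =>
      intro t ht
      rw [h t ht, abs_mul]
      have hint : |∫ s in a..t, K t s * d s| ≤
          M * (D * (|lam| * M) ^ n) * (|t - a| ^ (n + 1) / (n + 1).factorial) := by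
        refine abs_integral_le_of_abs_le_pow n fun z hz => ?_
        rw [Set.uIoc_of_le ht.1] at hz
        rw [abs_mul, mul_assoc]
        exact mul_le_mul (hM t z) (ih z ⟨hz.1.le, hz.2.trans ht.2⟩) (abs_nonneg _) hM0
      refine (mul_le_mul_of_nonneg_left hint (abs_nonneg lam)).trans_eq ?_
      ring
  intro t ht
  have hlim : Filter.Tendsto (fun n : ℕ => D * (|lam| * M) ^ n * (|t - a| ^ n / n.factorial))
      Filter.atTop (nhds 0) := by
    have h0 := (FloorSemiring.tendsto_pow_div_factorial_atTop (|lam| * M * |t - a|)).const_mul D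
    rw [mul_zero] at h0
    refine h0.congr fun n => ?_
    rw [mul_pow]
    ring
  exact abs_nonpos_iff.1 (ge_of_tendsto' hlim fun n => hbound n t ht)

/-- The resolvent formula solves the Volterra equation of the second kind. -/
theorem volterra_resolvent_solution {K : ℝ → ℝ → ℝ} (hK : Continuous (Function.uncurry K)) {M : ℝ}
    (hM : ∀ t s, |K t s| ≤ M) (lam : ℝ) {g : ℝ → ℝ} (hg : Continuous g) {a t : ℝ} (hat : a ≤ t) :
    ∫ s in a..t, resolventKernel K lam t s * g s =
      lam * ∫ s in a..t, K t s * (g s + ∫ r in a..s, resolventKernel K lam s r * g r) := by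
  have hR := continuous_resolventKernel hK hM lam
  have hKt : Continuous fun s => K t s := hK.comp (Continuous.prodMk_right t)
  have hRg : Continuous (Function.uncurry fun s r => resolventKernel K lam s r * g r) :=
    hR.mul (hg.comp continuous_snd)
  have hKRg : Continuous
      (Function.uncurry fun s r => K t s * (resolventKernel K lam s r * g r)) :=
    (hKt.comp continuous_fst).mul hRg
  have hRgint : Continuous fun s => ∫ r in a..s, resolventKernel K lam s r * g r :=
    intervalIntegral.continuous_parametric_intervalIntegral_of_continuous hRg continuous_id
  have hswap := integral_integral_swap_triangle hKRg hat
  simp only [intervalIntegral.integral_const_mul] at hswap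
  have hKg : IntervalIntegrable (fun s => K t s * g s) volume a t :=
    (hKt.mul hg).intervalIntegrable _ _
  have hKRgint : IntervalIntegrable
      (fun s => K t s * ∫ r in a..s, resolventKernel K lam s r * g r) volume a t :=
    (hKt.mul hRgint).intervalIntegrable _ _
  have hRt : Continuous fun s => resolventKernel K lam t s * g s :=
    hRg.comp (Continuous.prodMk_right t)
  have hpoint : ∀ s, lam * ∫ z in s..t, K t z * (resolventKernel K lam z s * g s) =
      resolventKernel K lam t s * g s - lam * (K t s * g s) := by
    intro s
    simp only [← mul_assoc, intervalIntegral.integral_mul_const]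
    rw [resolventKernel_eq hK hM lam t s]
    ring
  simp only [mul_add]
  rw [intervalIntegral.integral_add hKg hKRgint, hswap, mul_add,
    ← intervalIntegral.integral_const_mul lam (fun s => ∫ z in s..t, _)]
  simp only [hpoint]
  rw [intervalIntegral.integral_sub (hRt.intervalIntegrable _ _) (hKg.const_mul lam),
    intervalIntegral.integral_const_mul]
  ring

/-- A continuous function solves the Volterra equation of the second kind with continuous data iff
it is given by the resolvent formula. -/
theorem volterra_iff_resolvent {K : ℝ → ℝ → ℝ} (hK : Continuous (Function.uncurry K)) {M : ℝ}
    (hM : ∀ t s, |K t s| ≤ M) (lam : ℝ) {g x : ℝ → ℝ} (hg : Continuous g) (hx : Continuous x)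
    (a T : ℝ) :
    (∀ t ∈ Set.Icc a T, x t = lam * (∫ s in a..t, K t s * x s) + g t) ↔
      ∀ t ∈ Set.Icc a T, x t = g t + ∫ s in a..t, resolventKernel K lam t s * g s := by
  have hRg : Continuous (Function.uncurry fun s r => resolventKernel K lam s r * g r) :=
    (continuous_resolventKernel hK hM lam).mul (hg.comp continuous_snd)
  have hy : Continuous fun t => g t + ∫ s in a..t, resolventKernel K lam t s * g s :=
    hg.add (intervalIntegral.continuous_parametric_intervalIntegral_of_continuous hRg continuous_id)
  constructor
  · intro h t ht
    refine sub_eq_zero.1 (eq_zero_of_volterra (lam := lam) hM (hx.sub hy) (fun t ht => ?_) t ht)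
    have hKt : Continuous fun s => K t s := hK.comp (Continuous.prodMk_right t)
    have hKx : Continuous fun s => K t s * x s := hKt.mul hx
    have hKy : Continuous fun s => K t s *
        (g s + ∫ r in a..s, resolventKernel K lam s r * g r) := hKt.mul hy
    simp only [Pi.sub_apply, mul_sub]
    rw [intervalIntegral.integral_sub (hKx.intervalIntegrable _ _)
      (hKy.intervalIntegrable _ _), mul_sub,
      ← volterra_resolvent_solution hK hM lam hg ht.1, h t ht]
    ring
  · intro h t ht
    have hcongr : ∫ s in a..t, K t s * x s = ∫ s in a..t, K t s *
        (g s + ∫ r in a..s, resolventKernel K lam s r * g r) := by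
      refine intervalIntegral.integral_congr fun s hs => ?_
      rw [Set.uIcc_of_le ht.1] at hs
      simp only [h s ⟨hs.1, hs.2.trans ht.2⟩]
    rw [hcongr, ← volterra_resolvent_solution hK hM lam hg ht.1, h t ht]
    ring

/-- A kernel continuous on the triangle `a ≤ s ≤ t ≤ T` extends to a bounded continuous kernel on
the plane. -/
theorem exists_continuous_bounded_kernel_extension {K : ℝ → ℝ → ℝ} {a T : ℝ} (haT : a ≤ T)
    (hK : ContinuousOn (fun q : ℝ × ℝ => K q.1 q.2)
      {q : ℝ × ℝ | a ≤ q.2 ∧ q.2 ≤ q.1 ∧ q.1 ≤ T}) :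
    ∃ (K' : ℝ → ℝ → ℝ) (M : ℝ), Continuous (Function.uncurry K') ∧ (∀ t s, |K' t s| ≤ M) ∧
      ∀ t s, a ≤ s → s ≤ t → t ≤ T → K' t s = K t s := by
  let ρ : ℝ × ℝ → ℝ × ℝ := fun q =>
    (max a (min T q.1), max a (min q.2 (max a (min T q.1))))
  have hρ : Continuous ρ := by fun_prop
  have hρmem : ∀ q, ρ q ∈ {q : ℝ × ℝ | a ≤ q.2 ∧ q.2 ≤ q.1 ∧ q.1 ≤ T} := fun q =>
    ⟨le_max_left _ _, max_le (le_max_left _ _) (min_le_right _ _),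
      max_le haT (min_le_left _ _)⟩
  have hcompact : IsCompact {q : ℝ × ℝ | a ≤ q.2 ∧ q.2 ≤ q.1 ∧ q.1 ≤ T} := by
    refine (isCompact_Icc (a := ((a, a) : ℝ × ℝ)) (b := (T, T))).of_isClosed_subset ?_ ?_
    · exact (isClosed_le continuous_const continuous_snd).inter
        ((isClosed_le continuous_snd continuous_fst).inter
          (isClosed_le continuous_fst continuous_const))
    · rintro q ⟨h1, h2, h3⟩
      exact ⟨⟨h1.trans h2, h1⟩, ⟨h3, h2.trans h3⟩⟩
  obtain ⟨M, hM⟩ := hcompact.exists_bound_of_continuousOn hK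
  refine ⟨fun t s => K (ρ (t, s)).1 (ρ (t, s)).2, M, hK.comp_continuous hρ hρmem,
    fun t s => hM _ (hρmem (t, s)), fun t s h1 h2 h3 => ?_⟩
  have ht : max a (min T t) = t := by rw [min_eq_right h3, max_eq_right (h1.trans h2)]
  have hs : max a (min s t) = s := by rw [min_eq_left h2, max_eq_right h1]
  simp only [ρ, ht, hs]



/-- A continuous x solves the loaded Volterra integral equation iff it satisfies the
reduced (load-only) equation x(t) + Σⱼ bⱼ(t,λ) x(tⱼ) = F(t,λ) on [t₀,T]. -/
theorem lvie_iff_reduced_equation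
    (t₀ T : ℝ) (ht : t₀ < T) (m : ℕ) (hm : 2 ≤ m)
    (p : Fin (m - 1) → ℝ) (hpmono : StrictMono p)
    (hp : ∀ j, t₀ < p j ∧ p j < T)
    (f : ℝ → ℝ) (hf : ContinuousOn f (Set.Icc t₀ T))
    (a : Fin (m - 1) → ℝ → ℝ) (ha : ∀ j, ContinuousOn (a j) (Set.Icc t₀ T))
    (K : ℝ → ℝ → ℝ)
    (hK : ContinuousOn (fun q : ℝ × ℝ => K q.1 q.2)
      {q : ℝ × ℝ | t₀ ≤ q.2 ∧ q.2 ≤ q.1 ∧ q.1 ≤ T})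
    (lam : ℝ)
    (Kn : ℕ → ℝ → ℝ → ℝ)
    (hKn1 : ∀ t s, Kn 1 t s = K t s)
    (hKnrec : ∀ n, 2 ≤ n → ∀ t s, Kn n t s = ∫ z in s..t, K t z * Kn (n - 1) z s)
    (R : ℝ → ℝ → ℝ → ℝ)
    (hR : ∀ t s lam', R t s lam' = ∑' n : ℕ, lam' ^ (n + 1) * Kn (n + 1) t s)
    (F : ℝ → ℝ → ℝ)
    (hF : ∀ t lam', F t lam' = f t + ∫ s in t₀..t, R t s lam' * f s)
    (b : Fin (m - 1) → ℝ → ℝ → ℝ)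
    (hb : ∀ j t lam', b j t lam' = a j t + ∫ s in t₀..t, R t s lam' * a j s)
    (x : ℝ → ℝ) (hx : ContinuousOn x (Set.Icc t₀ T)) :
    (∀ t ∈ Set.Icc t₀ T,
        x t + ∑ j, a j t * x (p j) = lam * (∫ s in t₀..t, K t s * x s) + f t) ↔
    (∀ t ∈ Set.Icc t₀ T,
        x t + ∑ j, b j t lam * x (p j) = F t lam) := by
  obtain ⟨K', M, hK', hM, hKK'⟩ := exists_continuous_bounded_kernel_extension ht.le hK
  have hKn : ∀ n t s, t₀ ≤ s → s ≤ t → t ≤ T → Kn (n + 1) t s = iteratedKernel K' n t s := by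
    intro n
    induction n with
    | zero => exact fun t s h1 h2 h3 => (hKn1 t s).trans (hKK' t s h1 h2 h3).symm
    | succ n ih =>
      intro t s h1 h2 h3
      rw [hKnrec (n + 1 + 1) (by omega), iteratedKernel]
      refine intervalIntegral.integral_congr fun z hz => ?_
      rw [Set.uIcc_of_le h2] at hz
      simp only [Nat.add_sub_cancel]
      rw [ih z s h1 hz.1 (hz.2.trans h3), hKK' t z (h1.trans hz.1) hz.2 h3]
  have hRR' : ∀ t s, t₀ ≤ s → s ≤ t → t ≤ T → R t s lam = resolventKernel K' lam t s := by
    intro t s h1 h2 h3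
    rw [hR]
    exact tsum_congr fun n => by rw [hKn n t s h1 h2 h3]
  have hext : ∀ u : ℝ → ℝ, ContinuousOn u (Set.Icc t₀ T) →
      ∃ u' : ℝ → ℝ, Continuous u' ∧ ∀ t ∈ Set.Icc t₀ T, u' t = u t := fun u hu =>
    ⟨Set.IccExtend ht.le ((Set.Icc t₀ T).domRestrict u), hu.domRestrict.Icc_extend',
      fun t h => Set.IccExtend_of_mem ht.le _ h⟩
  obtain ⟨f', hf', hff'⟩ := hext f hf
  obtain ⟨x', hx', hxx'⟩ := hext x hx
  choose a' ha' haa' using fun j => hext (a j) (ha j)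
  have hg : Continuous fun t => f' t - ∑ j, a' j t * x (p j) := by fun_prop
  have hRcont := continuous_resolventKernel hK' hM lam
  have hintR : ∀ t ∈ Set.Icc t₀ T, ∀ u u' : ℝ → ℝ, (∀ t ∈ Set.Icc t₀ T, u' t = u t) →
      ∫ s in t₀..t, R t s lam * u s = ∫ s in t₀..t, resolventKernel K' lam t s * u' s := by
    intro t h u u' huu'
    refine intervalIntegral.integral_congr fun s hs => ?_
    rw [Set.uIcc_of_le h.1] at hs
    simp only [hRR' t s hs.1 hs.2 h.2, huu' s ⟨hs.1, hs.2.trans h.2⟩]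
  have hmain := volterra_iff_resolvent hK' hM lam hg hx' t₀ T
  refine Iff.trans (forall₂_congr fun t h => ?_) (hmain.trans (forall₂_congr fun t h => ?_))
  · have hcongr : ∫ s in t₀..t, K t s * x s = ∫ s in t₀..t, K' t s * x' s := by
      refine intervalIntegral.integral_congr fun s hs => ?_
      rw [Set.uIcc_of_le h.1] at hs
      simp only [hKK' t s hs.1 hs.2 h.2, hxx' s ⟨hs.1, hs.2.trans h.2⟩]
    simp only [hxx' t h, hff' t h, haa' _ t h, hcongr]
    constructor <;> intro h' <;> linarith
  · have hRt : Continuous fun s => resolventKernel K' lam t s :=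
      hRcont.comp (Continuous.prodMk_right t)
    have hsplit : ∫ s in t₀..t, resolventKernel K' lam t s * (f' s - ∑ j, a' j s * x (p j)) =
        (∫ s in t₀..t, resolventKernel K' lam t s * f' s) -
          ∑ j, (∫ s in t₀..t, resolventKernel K' lam t s * a' j s) * x (p j) := by
      simp only [mul_sub, Finset.mul_sum, ← mul_assoc]
      have hterm : ∀ j, Continuous fun s => resolventKernel K' lam t s * a' j s * x (p j) :=
        fun j => (hRt.mul (ha' j)).mul continuous_const
      have hRf : Continuous fun s => resolventKernel K' lam t s * f' s := hRt.mul hf'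
      rw [intervalIntegral.integral_sub (hRf.intervalIntegrable _ _)
        ((continuous_finsetSum _ fun j _ => hterm j).intervalIntegrable _ _),
        intervalIntegral.integral_finsetSum fun j _ => (hterm j).intervalIntegrable _ _]
      simp only [intervalIntegral.integral_mul_const]
    rw [hsplit, hF, hintR t h f f' hff']
    simp only [hb, hintR t h _ _ (haa' _), hxx' t h, hff' t h, haa' _ t h, add_mul,
      Finset.sum_add_distrib]
    constructor <;> intro h' <;> linarith
end

section
/- If det A(λ) ≠ 0, then the homogeneous loaded Volterra integral equation (the LVIE with f ≡ 0) has only the trivial continuous solution x ≡ 0. -/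
open MeasureTheory Matrix

/-- Fubini's theorem on the triangle `a ≤ s ≤ z ≤ b`. -/
theorem intervalIntegral_triangle_swap {F : ℝ → ℝ → ℝ} (hF : Continuous F.uncurry)
    {a b : ℝ} (hab : a ≤ b) :
    ∫ z in a..b, ∫ s in a..z, F z s = ∫ s in a..b, ∫ z in s..b, F z s := by
  set S : Set (ℝ × ℝ) := {q | q.2 < q.1} with hS
  have hSm : MeasurableSet S := measurableSet_lt measurable_snd measurable_fst
  set G : ℝ → ℝ → ℝ := fun z s => S.indicator F.uncurry (z, s) with hG
  have hint : Integrable G.uncurry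
      ((volume.restrict (Set.Ioc a b)).prod (volume.restrict (Set.Ioc a b))) := by
    have h1 : IntegrableOn F.uncurry (Set.Icc a b ×ˢ Set.Icc a b) :=
      hF.continuousOn.integrableOn_compact (isCompact_Icc.prod isCompact_Icc)
    have h2 := h1.mono_set (Set.prod_mono (Set.Ioc_subset_Icc_self (a := a) (b := b))
      (Set.Ioc_subset_Icc_self (a := a) (b := b)))
    rw [IntegrableOn, Measure.volume_eq_prod, ← Measure.prod_restrict] at h2
    exact h2.indicator hSm
  have hl : ∫ z in a..b, ∫ s in a..z, F z s
      = ∫ z in Set.Ioc a b, ∫ s in Set.Ioc a b, G z s := by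
    rw [intervalIntegral.integral_of_le hab]
    refine setIntegral_congr_fun measurableSet_Ioc fun z hz => ?_
    have : ∀ s, G z s = (Set.Iio z).indicator (F z) s := fun s => by
      simp [hG, hS, Set.indicator_apply]
    simp only [this]
    rw [setIntegral_indicator measurableSet_Iio, intervalIntegral.integral_of_le hz.1.le,
      integral_Ioc_eq_integral_Ioo]
    congr 2
    ext s
    simp only [Set.mem_Ioo, Set.mem_inter_iff, Set.mem_Ioc, Set.mem_Iio]
    exact ⟨fun h => ⟨⟨h.1, h.2.le.trans hz.2⟩, h.2⟩, fun h => ⟨h.1.1, h.2⟩⟩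
  have hr : ∫ s in a..b, ∫ z in s..b, F z s
      = ∫ s in Set.Ioc a b, ∫ z in Set.Ioc a b, G z s := by
    rw [intervalIntegral.integral_of_le hab]
    refine setIntegral_congr_fun measurableSet_Ioc fun s hs => ?_
    have : ∀ z, G z s = (Set.Ioi s).indicator (fun z => F z s) z := fun z => by
      simp [hG, hS, Set.indicator_apply]
    simp only [this]
    rw [setIntegral_indicator measurableSet_Ioi, intervalIntegral.integral_of_le hs.2]
    congr 2
    ext z
    simp only [Set.mem_inter_iff, Set.mem_Ioc, Set.mem_Ioi]
    exact ⟨fun h => ⟨⟨hs.1.trans h.1, h.2⟩, h.1⟩, fun h => ⟨h.2, h.1.2⟩⟩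
  rw [hl, hr]
  exact integral_integral_swap hint

/-- The iterated kernels of a Volterra kernel `k`, with `volterraIter k 0 = k`. -/
noncomputable def volterraIter (k : ℝ → ℝ → ℝ) : ℕ → ℝ → ℝ → ℝ
  | 0 => k
  | n + 1 => fun t s => ∫ z in s..t, k t z * volterraIter k n z s

theorem continuous_volterraIter {k : ℝ → ℝ → ℝ} (hk : Continuous k.uncurry) (n : ℕ) :
    Continuous (volterraIter k n).uncurry := by
  induction n with
  | zero => exact hk
  | succ n ih =>
    have hc : Continuous (Function.uncurry
        fun (q : ℝ × ℝ) (z : ℝ) => k q.1 z * volterraIter k n z q.2) := by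
      refine Continuous.mul (f := fun r : (ℝ × ℝ) × ℝ => k r.1.1 r.2)
        (g := fun r : (ℝ × ℝ) × ℝ => volterraIter k n r.2 r.1.2) ?_ ?_
      · exact hk.comp ((continuous_fst.comp continuous_fst).prodMk continuous_snd)
      · exact ih.comp (continuous_snd.prodMk (continuous_snd.comp continuous_fst))
    have heq : (volterraIter k (n + 1)).uncurry = fun q : ℝ × ℝ =>
        (∫ z in (0 : ℝ)..q.1, k q.1 z * volterraIter k n z q.2)
          - ∫ z in (0 : ℝ)..q.2, k q.1 z * volterraIter k n z q.2 := by
      funext q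
      have hq : Continuous fun z => k q.1 z * volterraIter k n z q.2 :=
        hc.comp (continuous_const.prodMk continuous_id)
      rw [intervalIntegral.integral_interval_sub_left (hq.intervalIntegrable _ _)
        (hq.intervalIntegrable _ _)]
      rfl
    rw [heq]
    exact (intervalIntegral.continuous_parametric_intervalIntegral_of_continuous hc
        continuous_fst).sub
      (intervalIntegral.continuous_parametric_intervalIntegral_of_continuous hc continuous_snd)

theorem abs_volterraIter_le {k : ℝ → ℝ → ℝ} {M : ℝ} (hM : ∀ t s, |k t s| ≤ M) (n : ℕ)
    {t s : ℝ} (hst : s ≤ t) :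
    |volterraIter k n t s| ≤ M ^ (n + 1) * ((t - s) ^ n / n.factorial) := by
  have hM0 : 0 ≤ M := (abs_nonneg _).trans (hM 0 0)
  induction n generalizing t with
  | zero => simpa [volterraIter] using hM t s
  | succ n ih =>
    have hb : ‖∫ z in s..t, k t z * volterraIter k n z s‖
        ≤ ∫ z in s..t, M * (M ^ (n + 1) * ((z - s) ^ n / n.factorial)) := by
      refine intervalIntegral.norm_integral_le_of_norm_le hst
        (Filter.Eventually.of_forall fun z hz => ?_)
        (Continuous.intervalIntegrable (by fun_prop) _ _)
      rw [norm_mul]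
      exact mul_le_mul (hM t z) (ih hz.1.le) (norm_nonneg _) hM0
    refine hb.trans (le_of_eq ?_)
    simp only [intervalIntegral.integral_const_mul, intervalIntegral.integral_div]
    rw [intervalIntegral.integral_comp_sub_right (fun z => z ^ n) s, integral_pow,
      Nat.factorial_succ]
    have : ((n : ℝ) + 1) ≠ 0 := by positivity
    have : (n.factorial : ℝ) ≠ 0 := by positivity
    push_cast
    simp only [sub_self, ne_eq, Nat.add_eq_zero_iff, one_ne_zero, and_false, not_false_eq_true,
      zero_pow, sub_zero]
    field_simp
    ring

/-- The Volterra integral operator with kernel `k` and base point `a`. -/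
noncomputable def volterraOp (a : ℝ) (k : ℝ → ℝ → ℝ) (f : ℝ → ℝ) (t : ℝ) : ℝ :=
  ∫ s in a..t, k t s * f s

theorem continuous_volterraOp {k : ℝ → ℝ → ℝ} (hk : Continuous k.uncurry) {f : ℝ → ℝ}
    (hf : Continuous f) (a : ℝ) : Continuous (volterraOp a k f) := by
  refine intervalIntegral.continuous_parametric_intervalIntegral_of_continuous ?_ continuous_id
  exact Continuous.mul (f := k.uncurry) hk (hf.comp continuous_snd)

theorem volterraOp_congr {k l : ℝ → ℝ → ℝ} {f g : ℝ → ℝ} {a t : ℝ} (ht : a ≤ t)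
    (h : ∀ s ∈ Set.Icc a t, k t s * f s = l t s * g s) :
    volterraOp a k f t = volterraOp a l g t := by
  refine intervalIntegral.integral_congr fun s hs => ?_
  rw [Set.uIcc_of_le ht] at hs
  exact h s hs

theorem volterraOp_comp_volterraIter {k : ℝ → ℝ → ℝ} (hk : Continuous k.uncurry) {f : ℝ → ℝ}
    (hf : Continuous f) {a t : ℝ} (ht : a ≤ t) (n : ℕ) :
    volterraOp a k (volterraOp a (volterraIter k n) f) t
      = volterraOp a (volterraIter k (n + 1)) f t := by
  have hF : Continuous (Function.uncurry fun z s => k t z * (volterraIter k n z s * f s)) := by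
    refine Continuous.mul (f := fun r : ℝ × ℝ => k t r.1)
      (g := fun r : ℝ × ℝ => volterraIter k n r.1 r.2 * f r.2) ?_ ?_
    · exact hk.comp (continuous_const.prodMk continuous_fst)
    · exact Continuous.mul (f := (volterraIter k n).uncurry) (continuous_volterraIter hk n)
        (hf.comp continuous_snd)
  have := intervalIntegral_triangle_swap hF ht
  simp only [volterraOp, volterraIter, ← intervalIntegral.integral_mul_const, mul_assoc]
  simpa only [intervalIntegral.integral_const_mul] using this

theorem volterraIter_comp_volterraOp {k : ℝ → ℝ → ℝ} (hk : Continuous k.uncurry) {f : ℝ → ℝ}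
    (hf : Continuous f) {a t : ℝ} (ht : a ≤ t) (n : ℕ) :
    volterraOp a (volterraIter k n) (volterraOp a k f) t
      = volterraOp a (volterraIter k (n + 1)) f t := by
  induction n generalizing t with
  | zero => exact volterraOp_comp_volterraIter hk hf ht 0
  | succ n ih =>
    rw [← volterraOp_comp_volterraIter hk (continuous_volterraOp hk hf a) ht,
      ← volterraOp_comp_volterraIter hk hf ht]
    exact volterraOp_congr ht fun s hs => by rw [ih hs.1]

/-- Termwise integration of the resolvent series of a bounded continuous kernel. -/
theorem hasSum_volterraOp_volterraIter {k : ℝ → ℝ → ℝ} (hk : Continuous k.uncurry) {M : ℝ}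
    (hM : ∀ t s, |k t s| ≤ M) {f : ℝ → ℝ} (hf : Continuous f) {a t : ℝ} (ht : a ≤ t)
    (lam : ℝ) :
    HasSum (fun n => lam ^ (n + 1) * volterraOp a (volterraIter k n) f t)
      (∫ s in a..t, (∑' n, lam ^ (n + 1) * volterraIter k n t s) * f s) := by
  have hM0 : 0 ≤ M := (abs_nonneg _).trans (hM 0 0)
  obtain ⟨C, hC⟩ := (isCompact_Icc (a := a) (b := t)).exists_bound_of_continuousOn hf.continuousOn
  set c : ℕ → ℝ := fun n => |lam| * M * ((|lam| * M * (t - a)) ^ n / n.factorial) with hc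
  have hcs : Summable c := (Real.summable_pow_div_factorial _).mul_left _
  have hle : ∀ n, ∀ s ∈ Set.Icc a t, |lam ^ (n + 1) * volterraIter k n t s| ≤ c n := by
    intro n s hs
    have h1 := abs_volterraIter_le hM n hs.2
    have h2 : (t - s) ^ n ≤ (t - a) ^ n :=
      pow_le_pow_left₀ (by linarith [hs.2]) (by linarith [hs.1]) n
    calc |lam ^ (n + 1) * volterraIter k n t s|
        = |lam| ^ (n + 1) * |volterraIter k n t s| := by rw [abs_mul, abs_pow]
      _ ≤ |lam| ^ (n + 1) * (M ^ (n + 1) * ((t - a) ^ n / n.factorial)) := by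
          refine mul_le_mul_of_nonneg_left (h1.trans ?_) (by positivity)
          gcongr
      _ = c n := by simp only [hc, mul_pow]; ring
  have hmem : ∀ s ∈ Set.uIoc a t, s ∈ Set.Icc a t := fun s hs => by
    rw [Set.uIoc_of_le ht] at hs
    exact Set.Ioc_subset_Icc_self hs
  have key := intervalIntegral.hasSum_integral_of_dominated_convergence (μ := volume)
    (a := a) (b := t) (F := fun n s => lam ^ (n + 1) * volterraIter k n t s * f s)
    (f := fun s => (∑' n, lam ^ (n + 1) * volterraIter k n t s) * f s)
    (fun n _ => c n * C) ?_ ?_ ?_ ?_ ?_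
  · simpa only [volterraOp, ← intervalIntegral.integral_const_mul, mul_assoc] using key
  · intro n
    have : Continuous fun s => volterraIter k n t s :=
      (continuous_volterraIter hk n).comp (continuous_const.prodMk continuous_id)
    exact ((this.const_mul _).mul hf).aestronglyMeasurable
  · refine fun n => Filter.Eventually.of_forall fun s hs => ?_
    rw [norm_mul]
    exact mul_le_mul (hle n s (hmem s hs)) (hC s (hmem s hs)) (norm_nonneg _)
      ((abs_nonneg _).trans (hle n s (hmem s hs)))
  · exact Filter.Eventually.of_forall fun s _ => hcs.mul_right C
  · exact intervalIntegrable_const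
  · refine Filter.Eventually.of_forall fun s hs => HasSum.mul_right _ ?_
    exact (Summable.of_norm_bounded hcs fun n => hle n s (hmem s hs)).hasSum

/-- A solution of `x = g + λ V x` is given by the resolvent series applied to `g`. -/
theorem hasSum_volterra_solution {k : ℝ → ℝ → ℝ} (hk : Continuous k.uncurry) {M : ℝ}
    (hM : ∀ t s, |k t s| ≤ M) {x g : ℝ → ℝ} (hx : Continuous x) {a t : ℝ}
    (ht : a ≤ t) {lam : ℝ}
    (h : ∀ s ∈ Set.Icc a t, x s = g s + lam * volterraOp a k x s) :
    HasSum (fun n => lam ^ (n + 1) * volterraOp a (volterraIter k n) g t) (x t - g t) := by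
  have hs := (hasSum_volterraOp_volterraIter hk hM hx ht lam).summable
  set u : ℕ → ℝ := fun n => lam ^ (n + 1) * volterraOp a (volterraIter k n) x t with hu
  have hterm : ∀ n, lam ^ (n + 1) * volterraOp a (volterraIter k n) g t = u n - u (n + 1) := by
    intro n
    have hkn : Continuous fun s => volterraIter k n t s :=
      (continuous_volterraIter hk n).comp (continuous_const.prodMk continuous_id)
    have hVx := continuous_volterraOp hk hx a
    have : volterraOp a (volterraIter k n) g t
        = volterraOp a (volterraIter k n) x t
          - lam * volterraOp a (volterraIter k n) (volterraOp a k x) t := by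
      have h1 : volterraOp a (volterraIter k n) g t
          = volterraOp a (volterraIter k n) (fun s => x s - lam * volterraOp a k x s) t :=
        volterraOp_congr ht fun s hs => by rw [h s hs]; ring
      rw [h1]
      have hi1 : IntervalIntegrable (fun s => volterraIter k n t s * x s) volume a t :=
        (hkn.mul hx).intervalIntegrable _ _
      have hi2 : IntervalIntegrable
          (fun s => lam * (volterraIter k n t s * volterraOp a k x s)) volume a t :=
        ((hkn.mul hVx).const_mul lam).intervalIntegrable _ _
      rw [volterraOp, volterraOp, volterraOp, ← intervalIntegral.integral_const_mul,
        ← intervalIntegral.integral_sub hi1 hi2]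
      congr 1
      funext s
      ring
    rw [this, volterraIter_comp_volterraOp hk hx ht]
    simp only [hu]
    ring
  have h0 : x t - g t = u 0 := by
    have := h t ⟨ht, le_rfl⟩
    simp only [hu, volterraIter, zero_add, pow_one]
    linarith
  have hs1 : HasSum (fun n => u (n + 1)) (∑' n, u n - u 0) := by
    simpa using (hasSum_nat_add_iff' 1).2 hs.hasSum
  have := hs.hasSum.sub hs1
  rw [h0]
  simpa only [hterm, sub_sub_cancel] using this

/-- If det A(λ) ≠ 0, the homogeneous LVIE has only the trivial continuous solution. -/
theorem homogeneous_lvie_only_trivial_solution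
    (t₀ T : ℝ) (ht : t₀ < T) (m : ℕ) (hm : 2 ≤ m)
    (p : Fin (m - 1) → ℝ) (hpmono : StrictMono p)
    (hp : ∀ j, t₀ < p j ∧ p j < T)
    (a : Fin (m - 1) → ℝ → ℝ) (ha : ∀ j, ContinuousOn (a j) (Set.Icc t₀ T))
    (K : ℝ → ℝ → ℝ)
    (hK : ContinuousOn (fun q : ℝ × ℝ => K q.1 q.2)
      {q : ℝ × ℝ | t₀ ≤ q.2 ∧ q.2 ≤ q.1 ∧ q.1 ≤ T})
    (lam : ℝ)
    (Kn : ℕ → ℝ → ℝ → ℝ)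
    (hKn1 : ∀ t s, Kn 1 t s = K t s)
    (hKnrec : ∀ n, 2 ≤ n → ∀ t s, Kn n t s = ∫ z in s..t, K t z * Kn (n - 1) z s)
    (R : ℝ → ℝ → ℝ → ℝ)
    (hR : ∀ t s lam', R t s lam' = ∑' n : ℕ, lam' ^ (n + 1) * Kn (n + 1) t s)
    (b : Fin (m - 1) → ℝ → ℝ → ℝ)
    (hb : ∀ j t lam', b j t lam' = a j t + ∫ s in t₀..t, R t s lam' * a j s)
    (A : Matrix (Fin (m - 1)) (Fin (m - 1)) ℝ)
    (hA : ∀ i j, A i j = (if i = j then 1 else 0) + b j (p i) lam)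
    (hdet : A.det ≠ 0) :
    ∀ x : ℝ → ℝ, ContinuousOn x (Set.Icc t₀ T) →
      (∀ t ∈ Set.Icc t₀ T,
        x t + ∑ j, a j t * x (p j) = lam * (∫ s in t₀..t, K t s * x s)) →
      ∀ t ∈ Set.Icc t₀ T, x t = 0 := by
  
  intro x hx heq
  set P : ℝ → ℝ := fun t => max t₀ (min t T) with hP
  have hPc : Continuous P := by fun_prop
  have hPmem : ∀ t, P t ∈ Set.Icc t₀ T := fun t =>
    ⟨le_max_left _ _, max_le ht.le (min_le_right _ _)⟩
  have hPid : ∀ t ∈ Set.Icc t₀ T, P t = t := fun t h => by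
    simp [hP, min_eq_left h.2, max_eq_right h.1]
  -- Extend the data continuously to the whole line and plane.
  set k : ℝ → ℝ → ℝ := fun t s => K (P t) (min (P t) (P s)) with hkdef
  have hk : Continuous k.uncurry := by
    refine hK.comp_continuous (f := fun q : ℝ × ℝ => (P q.1, min (P q.1) (P q.2)))
      (by fun_prop) fun q => ?_
    exact ⟨le_min (hPmem _).1 (hPmem _).1, min_le_left _ _, (hPmem _).2⟩
  have hkK : ∀ t s, t₀ ≤ s → s ≤ t → t ≤ T → k t s = K t s := fun t s h1 h2 h3 => by
    simp only [hkdef]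
    rw [hPid t ⟨h1.trans h2, h3⟩, hPid s ⟨h1, h2.trans h3⟩, min_eq_right h2]
  obtain ⟨M, hM⟩ : ∃ M, ∀ t s, |k t s| ≤ M := by
    obtain ⟨M, hM⟩ := ((isCompact_Icc (a := t₀) (b := T)).prod
      (isCompact_Icc (a := t₀) (b := T))).exists_bound_of_continuousOn hk.continuousOn
    refine ⟨M, fun t s => ?_⟩
    have := hM (P t, P s) ⟨hPmem t, hPmem s⟩
    simpa only [Function.uncurry, hkdef, hPid _ (hPmem _), Real.norm_eq_abs] using this
  have hextc : ∀ f : ℝ → ℝ, ContinuousOn f (Set.Icc t₀ T) → Continuous (f ∘ P) :=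
    fun f hf => hf.comp_continuous hPc hPmem
  have hKn : ∀ n t s, t₀ ≤ s → s ≤ t → t ≤ T → Kn (n + 1) t s = volterraIter k n t s := by
    intro n
    induction n with
    | zero => exact fun t s h1 h2 h3 => by rw [hKn1, volterraIter, hkK t s h1 h2 h3]
    | succ n ih =>
      intro t s h1 h2 h3
      rw [hKnrec (n + 1 + 1) (by omega)]
      refine intervalIntegral.integral_congr fun z hz => ?_
      rw [Set.uIcc_of_le h2] at hz
      simp only [Nat.add_sub_cancel]
      rw [ih z s h1 hz.1 (hz.2.trans h3), hkK t z (h1.trans hz.1) hz.2 h3]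
  have hb' : ∀ j, ∀ t ∈ Set.Icc t₀ T,
      HasSum (fun n => lam ^ (n + 1) * volterraOp t₀ (volterraIter k n) (a j ∘ P) t)
        (b j t lam - a j t) := by
    intro j t htm
    have h1 := hasSum_volterraOp_volterraIter hk hM (hextc _ (ha j)) htm.1 lam
    convert h1 using 1
    rw [hb, add_sub_cancel_left]
    refine intervalIntegral.integral_congr fun s hs => ?_
    rw [Set.uIcc_of_le htm.1] at hs
    simp only [hR, Function.comp_apply]
    rw [hPid s ⟨hs.1, hs.2.trans htm.2⟩]
    congr 2
    funext n
    rw [hKn n t s hs.1 hs.2 htm.2]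
  set c : Fin (m - 1) → ℝ := fun j => x (p j) with hc
  have hsol : ∀ t ∈ Set.Icc t₀ T, x t = -∑ j, c j * b j t lam := by
    intro t htm
    set g : ℝ → ℝ := fun s => -∑ j, c j * a j (P s) with hg
    have h1 : HasSum (fun n => lam ^ (n + 1) * volterraOp t₀ (volterraIter k n) g t)
        ((x ∘ P) t - g t) := by
      refine hasSum_volterra_solution hk hM (hextc x hx) htm.1 fun s hs => ?_
      have hsm : s ∈ Set.Icc t₀ T := ⟨hs.1, hs.2.trans htm.2⟩
      have h2 := heq s hsm
      have h3 : volterraOp t₀ k (x ∘ P) s = ∫ z in t₀..s, K s z * x z :=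
        volterraOp_congr (l := K) hs.1 fun z hz => by
          rw [hkK s z hz.1 hz.2 hsm.2, Function.comp_apply, hPid z ⟨hz.1, hz.2.trans hsm.2⟩]
      rw [h3, ← h2]
      simp only [hg, hc, Function.comp_apply, hPid s hsm, mul_comm (x (p _))]
      ring
    have h2 : HasSum (fun n => lam ^ (n + 1) * volterraOp t₀ (volterraIter k n) g t)
        (-∑ j, c j * (b j t lam - a j t)) := by
      have h4 : HasSum (fun n => -∑ j, c j *
          (lam ^ (n + 1) * volterraOp t₀ (volterraIter k n) (a j ∘ P) t))
          (-∑ j, c j * (b j t lam - a j t)) :=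
        (hasSum_sum fun j _ => (hb' j t htm).mul_left (c j)).neg
      convert h4 using 2 with n
      have hkn : Continuous fun s => volterraIter k n t s :=
        (continuous_volterraIter hk n).comp (continuous_const.prodMk continuous_id)
      have h3 : volterraOp t₀ (volterraIter k n) g t
          = -∑ j, c j * volterraOp t₀ (volterraIter k n) (a j ∘ P) t := by
        simp only [volterraOp, ← intervalIntegral.integral_const_mul]
        have hi : ∀ j ∈ Finset.univ, IntervalIntegrable
            (fun s => c j * (volterraIter k n t s * (a j ∘ P) s)) volume t₀ t := fun j _ =>
          ((hkn.mul (hextc _ (ha j))).const_mul (c j)).intervalIntegrable _ _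
        rw [← intervalIntegral.integral_finsetSum hi, ← intervalIntegral.integral_neg]
        congr 1
        funext s
        simp only [hg, mul_neg, Finset.mul_sum, Function.comp_apply]
        congr 1
        exact Finset.sum_congr rfl fun j _ => by ring
      rw [h3, mul_neg, Finset.mul_sum]
      congr 1
      exact Finset.sum_congr rfl fun j _ => by ring
    have h3 := h1.unique h2
    simp only [hg, Function.comp_apply, hPid t htm, mul_sub, Finset.sum_sub_distrib] at h3
    linarith
  have hAc : A *ᵥ c = 0 := by
    funext i
    have h1 := hsol (p i) ⟨(hp i).1.le, (hp i).2.le⟩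
    simp only [mulVec, dotProduct, hA, add_mul, Finset.sum_add_distrib, ite_mul, one_mul,
      zero_mul, Finset.sum_ite_eq, Finset.mem_univ, if_true, Pi.zero_apply]
    simp only [mul_comm (b _ _ _)]
    change x (p i) + _ = 0
    rw [h1]
    ring
  have hc0 : c = 0 := eq_zero_of_mulVec_eq_zero hdet hAc
  intro t htm
  rw [hsol t htm, hc0]
  simp
end
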